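/- Let g ≥ 1, let M be a free ℤ-module with a basis e indexed by Fin (2g), and let B : M → M → ℤ be a ℤ-bilinear alternating form (B(x,x) = 0 for all x) which is unimodular, i.e. the induced map M → Hom_ℤ(M, ℤ), x ↦ B(x, ·), is bijective. Then there exist indices i ≠ j in Fin (2g) with i < g+1 and j < g+1 (as natural numbers) such that B(e i, e j) is odd; in particular |B(e i, e j)| ≥ 1. -/

import Mathlib

/-- A square matrix with a vanishing principal block on more than half of its indices has
determinant zero. -/
theorem Matrix.det_eq_zero_of_card_lt_two_mul_card {n R : Type*} [Fintype n] [DecidableEq n]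
    [CommRing R] (A : Matrix n n R) (s : Finset n) (hs : Fintype.card n < 2 * s.card)
    (h : ∀ i ∈ s, ∀ j ∈ s, A i j = 0) : A.det = 0 := by
  rw [Matrix.det_apply]
  refine Finset.sum_eq_zero fun σ _ => ?_
  obtain ⟨i, hi, hσi⟩ : ∃ i ∈ s, σ i ∈ s := by
    by_contra! hc
    have hd : Disjoint s (s.map σ.toEmbedding) := by
      rw [Finset.disjoint_right]
      intro a ha
      obtain ⟨i, hi, rfl⟩ := Finset.mem_map.1 ha
      exact hc i hi
    have hle := Finset.card_le_univ (s.disjUnion _ hd)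
    rw [Finset.card_disjUnion, Finset.card_map] at hle
    omega
  have hprod : ∏ k, A (σ k) k = 0 := Finset.prod_eq_zero (Finset.mem_univ i) (h _ hσi _ hi)
  rw [hprod, smul_zero]

/-- The Gram matrix of a bilinear form inducing a surjection onto the dual module has unit
determinant. -/
theorem LinearMap.isUnit_det_toMatrix₂_of_surjective {ι R M : Type*} [Fintype ι] [DecidableEq ι]
    [CommRing R] [AddCommGroup M] [Module R M] (e : Module.Basis ι R M)
    (B : M →ₗ[R] M →ₗ[R] R) (hB : Function.Surjective fun x : M => B x) :
    IsUnit (LinearMap.toMatrix₂ e e B).det := by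
  choose x hx using fun i => hB (e.coord i)
  refine Matrix.isUnit_det_of_left_inverse (B := Matrix.of fun i j => e.repr (x i) j) ?_
  ext i k
  have hk : B (x i) (e k) = e.coord i (e k) := LinearMap.congr_fun (hx i) (e k)
  rw [← e.sum_repr (x i), map_sum, LinearMap.sum_apply] at hk
  simpa [Matrix.mul_apply, LinearMap.toMatrix₂_apply, Matrix.one_apply,
    Finsupp.single_apply, eq_comm] using hk

/-- a unimodular alternating bilinear form on a free `ℤ`-module of rank `2g`
takes an odd value on some pair of distinct basis elements among the first `g + 1`. -/
theorem exists_odd_intersection_among_first (g : ℕ) (hg : 1 ≤ g)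
    (M : Type*) [AddCommGroup M] [Module ℤ M] (e : Module.Basis (Fin (2 * g)) ℤ M)
    (B : M →ₗ[ℤ] M →ₗ[ℤ] ℤ) (halt : ∀ x, B x x = 0)
    (hunimod : Function.Bijective fun x : M => B x) :
    ∃ i j : Fin (2 * g), i ≠ j ∧ (i : ℕ) < g + 1 ∧ (j : ℕ) < g + 1 ∧
      Odd (B (e i) (e j)) ∧ 1 ≤ |B (e i) (e j)| := by
  by_contra! hc
  have hu := (LinearMap.isUnit_det_toMatrix₂_of_surjective e B hunimod.2).map
    (Int.castRingHom (ZMod 2))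
  rw [RingHom.map_det] at hu
  refine hu.ne_zero (Matrix.det_eq_zero_of_card_lt_two_mul_card _
    (Finset.univ.map (Fin.castLEEmb (show g + 1 ≤ 2 * g by omega))) (by simp) ?_)
  simp only [Finset.mem_map, Finset.mem_univ, true_and, forall_exists_index,
    forall_apply_eq_imp_iff]
  intro i j
  set i' := Fin.castLEEmb (show g + 1 ≤ 2 * g by omega) i
  set j' := Fin.castLEEmb (show g + 1 ≤ 2 * g by omega) j
  suffices Even (B (e i') (e j')) by
    simpa [LinearMap.toMatrix₂_apply] using (ZMod.intCast_eq_zero_iff_even).2 this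
  by_cases hij : i' = j'
  · simp [hij, halt]
  · by_contra hodd
    rw [Int.not_even_iff_odd] at hodd
    have hlt := hc i' j' hij i.2 j.2 hodd
    rw [Int.abs_lt_one_iff] at hlt
    simp [hlt] at hodd
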